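/- Let N ≥ 1 be an integer, p ∈ (1,∞), s ∈ (0,1), Λ > 0, and let K : ℝ^N ∖ {0} → (0,∞) be measurable with K(-z) = K(z) and K(z) ≤ Λ |z|^{-(N+sp)} for all z ≠ 0. Let Ω ⊆ ℝ^N be open, 𝒦 ⊂ Ω compact, I ⊂ ℝ a bounded interval, and U open with 𝒦 ⊂ U and closure(U) compact and contained in Ω. Let φ ∈ C²_x ∩ C¹_t(U × I) be such that τ := sup_{U × I} |D²_x φ| < ∞, m := inf_{𝒦 × I} |∇_x φ| > 0 and M := sup_{𝒦 × I} |∇_x φ| < ∞. Then there exists a constant C > 0, depending only on N, p, s, Λ, τ, m, M (in particular independent of x, t, δ, ε), such that for every (x,t) ∈ 𝒦 × I and every 0 < δ < ε < min{dist(𝒦, ∂U), 1}: | ∫_{B_ε(x) ∖ B_δ(x)} J_p(φ(x,t) - φ(y,t)) K(x-y) dy | ≤ C ε^{p(1-s)}. -/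

import Mathlib

open MeasureTheory Set Metric Filter
open scoped ENNReal NNReal Topology Classical

noncomputable section

abbrev Euc (N : ℕ) := EuclideanSpace ℝ (Fin N)

/-- `J_p(t) = |t|^{p-2} t`. -/
def Jp (p t : ℝ) : ℝ := |t| ^ (p - 2) * t

/-- A symmetric kernel comparable to the fractional `p`-Laplace kernel. -/
def IsKernel (N : ℕ) (p s lam Lam : ℝ) (K : Euc N → ℝ) : Prop :=
  Measurable K ∧
  (∀ z : Euc N, z ≠ 0 → 0 < K z) ∧
  (∀ z : Euc N, z ≠ 0 → K (-z) = K z) ∧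
  (∀ z : Euc N, z ≠ 0 →
    lam * ‖z‖ ^ (-((N : ℝ) + s * p)) ≤ K z ∧ K z ≤ Lam * ‖z‖ ^ (-((N : ℝ) + s * p)))

/-- Local weak solution of `∂ₜ u + L_K u = 0` in `Ω × I`. -/
def IsLocalWeakSolution (N : ℕ) (p s : ℝ) (K : Euc N → ℝ)
    (Ω : Set (Euc N)) (I : Set ℝ) (u : Euc N → ℝ → ℝ) : Prop :=
  (∀ J : Set ℝ, IsCompact J → J ⊆ interior I →
    ∀ U : Set (Euc N), IsOpen U → IsCompact (closure U) → closure U ⊆ Ω →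
      (∫⁻ t in J, ∫⁻ x in U, ∫⁻ y in U,
          ENNReal.ofReal (|u x t - u y t| ^ p * ‖x - y‖ ^ (-((N : ℝ) + s * p)))) < ⊤ ∧
      (∫⁻ t in J, ∫⁻ x in U, ENNReal.ofReal (|u x t| ^ p)) < ⊤ ∧
      essSup (fun t => ∫⁻ x, ENNReal.ofReal (|u x t| ^ (p - 1) / (1 + ‖x‖ ^ ((N : ℝ) + s * p))))
        (volume.restrict J) < ⊤ ∧
      (∀ t₀ ∈ I, Tendsto (fun t => ∫ x in U, (u x t - u x t₀) ^ 2)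
          (nhdsWithin t₀ I) (nhds 0))) ∧
  (∀ φ : Euc N × ℝ → ℝ, ContDiff ℝ (⊤ : ℕ∞) φ → HasCompactSupport φ →
    tsupport φ ⊆ Ω ×ˢ interior I →
    -(∫ t in I, ∫ x in Ω, u x t * deriv (fun τ => φ (x, τ)) t) +
      (1 / 2) * ∫ t in I, ∫ x, ∫ y,
        Jp p (u x t - u y t) * (φ (x, t) - φ (y, t)) * K (x - y) = 0)

/-- Essential supremum of `|u|` over a space-time set. -/
def supAbs (N : ℕ) (u : Euc N → ℝ → ℝ) (Q : Set (Euc N × ℝ)) : ℝ≥0∞ :=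
  essSup (fun q : Euc N × ℝ => ENNReal.ofReal |u q.1 q.2|) (volume.restrict Q)

/-- The nonlocal tail `Tail(w; x₀, r)`. -/
def tailFn (N : ℕ) (p s : ℝ) (w : Euc N → ℝ) (x₀ : Euc N) (r : ℝ) : ℝ :=
  (r ^ (s * p) *
    ∫ x in (ball x₀ r)ᶜ, |w x| ^ (p - 1) * ‖x - x₀‖ ^ (-((N : ℝ) + s * p))) ^ (1 / (p - 1))

/-- The parabolic tail `Tail_∞(u; x₀, r, J)`. -/
def tailSup (N : ℕ) (p s : ℝ) (u : Euc N → ℝ → ℝ) (x₀ : Euc N) (r : ℝ) (J : Set ℝ) : ℝ≥0∞ :=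
  essSup (fun t => ENNReal.ofReal (tailFn N p s (fun x => u x t) x₀ r)) (volume.restrict J)

/-- `M_R = ‖u‖_{L^∞(Q_{2R,2R^{sp}}(x₀,t₀))} + Tail_∞(u; x₀, R, (t₀-2R^{sp},t₀]) + 1`. -/
def MR (N : ℕ) (p s : ℝ) (u : Euc N → ℝ → ℝ) (x₀ : Euc N) (R t₀ : ℝ) : ℝ≥0∞ :=
  supAbs N u (ball x₀ (2 * R) ×ˢ Ioc (t₀ - 2 * R ^ (s * p)) t₀)
    + tailSup N p s u x₀ R (Ioc (t₀ - 2 * R ^ (s * p)) t₀) + 1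

/-- `φ ∈ C²ₓ ∩ C¹ₜ(U × I)` with derivative data `Dφ, D2φ, φt`. -/
def C2xC1t (N : ℕ) (U : Set (Euc N)) (I : Set ℝ) (φ : Euc N → ℝ → ℝ)
    (Dφ : Euc N → ℝ → (Euc N →L[ℝ] ℝ)) (D2φ : Euc N → ℝ → (Euc N →L[ℝ] Euc N →L[ℝ] ℝ))
    (φt : Euc N → ℝ → ℝ) : Prop :=
  ContinuousOn (fun q : Euc N × ℝ => φ q.1 q.2) (U ×ˢ I) ∧
  (∀ x ∈ U, ∀ t ∈ I, HasFDerivAt (fun y => φ y t) (Dφ x t) x) ∧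
  ContinuousOn (fun q : Euc N × ℝ => Dφ q.1 q.2) (U ×ˢ I) ∧
  (∀ x ∈ U, ∀ t ∈ I, HasFDerivAt (fun y => Dφ y t) (D2φ x t) x) ∧
  ContinuousOn (fun q : Euc N × ℝ => D2φ q.1 q.2) (U ×ˢ I) ∧
  (∀ x ∈ U, ∀ t ∈ I, HasDerivWithinAt (fun τ => φ x τ) (φt x t) I t) ∧
  ContinuousOn (fun q : Euc N × ℝ => φt q.1 q.2) (U ×ˢ I)

/-- The truncated integral over the annulus `δ < |x - y| < ρ`. -/
def pvIntegral (N : ℕ) (p ρ : ℝ) (K : Euc N → ℝ) (w : Euc N → ℝ) (x : Euc N) (δ : ℝ) : ℝ :=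
  ∫ y in {y : Euc N | δ < dist y x ∧ dist y x < ρ}, Jp p (w x - w y) * K (x - y)

/-- Existence of the principal value `L_K^{B_ρ} w (x) = l`. -/
def HasPV (N : ℕ) (p ρ : ℝ) (K : Euc N → ℝ) (w : Euc N → ℝ) (x : Euc N) (l : ℝ) : Prop :=
  Tendsto (fun δ => pvIntegral N p ρ K w x δ) (nhdsWithin 0 (Ioi 0)) (nhds l)

/-- Weak supersolution of `∂ₜ w + L_K^{B_ρ} w = f` in `U × I`. -/
def IsTruncSuper (N : ℕ) (p ρ : ℝ) (K : Euc N → ℝ) (U : Set (Euc N)) (I : Set ℝ)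
    (f w : Euc N → ℝ → ℝ) : Prop :=
  ∀ φ : Euc N × ℝ → ℝ, ContDiff ℝ (⊤ : ℕ∞) φ → HasCompactSupport φ →
    tsupport φ ⊆ U ×ˢ interior I → (∀ q, 0 ≤ φ q) →
    ∫ t in I, ∫ x in U, f x t * φ (x, t) ≤
      -(∫ t in I, ∫ x in U, w x t * deriv (fun τ => φ (x, τ)) t) +
        (1 / 2) * ∫ t in I, ∫ q in {q : Euc N × Euc N | dist q.1 q.2 < ρ},
          Jp p (w q.1 t - w q.2 t) * (φ (q.1, t) - φ (q.2, t)) * K (q.1 - q.2)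

/-- Weak subsolution of `∂ₜ w + L_K^{B_ρ} w = f` in `U × I`. -/
def IsTruncSub (N : ℕ) (p ρ : ℝ) (K : Euc N → ℝ) (U : Set (Euc N)) (I : Set ℝ)
    (f w : Euc N → ℝ → ℝ) : Prop :=
  ∀ φ : Euc N × ℝ → ℝ, ContDiff ℝ (⊤ : ℕ∞) φ → HasCompactSupport φ →
    tsupport φ ⊆ U ×ˢ interior I → (∀ q, 0 ≤ φ q) →
    -(∫ t in I, ∫ x in U, w x t * deriv (fun τ => φ (x, τ)) t) +
        (1 / 2) * ∫ t in I, ∫ q in {q : Euc N × Euc N | dist q.1 q.2 < ρ},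
          Jp p (w q.1 t - w q.2 t) * (φ (q.1, t) - φ (q.2, t)) * K (q.1 - q.2) ≤
      ∫ t in I, ∫ x in U, f x t * φ (x, t)


lemma Jp_neg' (p t : ℝ) : Jp p (-t) = -Jp p t := by simp [Jp]

lemma Jp_of_pos (p : ℝ) {t : ℝ} (ht : 0 < t) : Jp p t = t ^ (p - 1) := by
  unfold Jp
  rw [abs_of_pos ht, show p - 1 = (p - 2) + 1 by ring, Real.rpow_add_one ht.ne']

lemma abs_Jp (p t : ℝ) (hp : 1 < p) : |Jp p t| = |t| ^ (p - 1) := by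
  rcases lt_trichotomy t 0 with h | h | h
  · rw [← neg_neg t, Jp_neg', abs_neg, Jp_of_pos p (neg_pos.2 h), abs_neg,
      abs_of_pos (neg_pos.2 h), abs_of_nonneg (Real.rpow_nonneg (neg_pos.2 h).le _)]
  · subst h
    simp [Jp, Real.zero_rpow (by linarith : p - 1 ≠ 0)]
  · rw [Jp_of_pos p h, abs_of_pos h, abs_of_nonneg (Real.rpow_nonneg h.le _)]

/-- tangent bound, convex case -/
lemma rpow_sub_le_convex {q A B L : ℝ} (hq : 1 ≤ q) (hB : 0 < B) (hBA : B ≤ A) (hAL : A ≤ L) :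
    A ^ q - B ^ q ≤ q * L ^ (q - 1) * (A - B) := by
  have hA : 0 < A := hB.trans_le hBA
  have h := one_add_mul_self_le_rpow_one_add (s := B / A - 1) (by have := div_pos hB hA; linarith) hq
  rw [show 1 + (B / A - 1) = B / A by ring, Real.div_rpow hB.le hA.le] at h
  have hAq : 0 < A ^ q := Real.rpow_pos_of_pos hA q
  rw [le_div_iff₀ hAq] at h
  have e : A ^ q = A ^ (q - 1) * A := by rw [← Real.rpow_add_one hA.ne']; ring_nf
  have e2 : q * (B / A - 1) * A ^ q = -(q * A ^ (q - 1) * (A - B)) := by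
    rw [e]; field_simp; ring
  have h3 : A ^ (q - 1) ≤ L ^ (q - 1) := Real.rpow_le_rpow hA.le hAL (by linarith)
  have h4 : q * A ^ (q - 1) * (A - B) ≤ q * L ^ (q - 1) * (A - B) := by
    have : 0 ≤ A - B := by linarith
    gcongr
  nlinarith

/-- tangent bound, concave case -/
lemma rpow_sub_le_concave {q A B l : ℝ} (hq0 : 0 < q) (hq : q ≤ 1) (hl : 0 < l) (hlB : l ≤ B)
    (hBA : B ≤ A) :
    A ^ q - B ^ q ≤ l ^ (q - 1) * (A - B) := by
  have hB : 0 < B := hl.trans_le hlB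
  have hA : 0 < A := hB.trans_le hBA
  have h := rpow_one_add_le_one_add_mul_self (s := A / B - 1)
    (by have := div_pos hA hB; linarith) hq0.le hq
  rw [show 1 + (A / B - 1) = A / B by ring, Real.div_rpow hA.le hB.le] at h
  have hBq : 0 < B ^ q := Real.rpow_pos_of_pos hB q
  rw [div_le_iff₀ hBq] at h
  have e : B ^ q = B ^ (q - 1) * B := by rw [← Real.rpow_add_one hB.ne']; ring_nf
  have e2 : q * (A / B - 1) * B ^ q = q * B ^ (q - 1) * (A - B) := by
    rw [e]; field_simp
  have h3 : B ^ (q - 1) ≤ l ^ (q - 1) := Real.rpow_le_rpow_of_nonpos hl hlB (by linarith)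
  have h5 : 0 ≤ B ^ (q - 1) := Real.rpow_nonneg hB.le _
  have h4 : q * B ^ (q - 1) * (A - B) ≤ l ^ (q - 1) * (A - B) := by
    have : 0 ≤ A - B := by linarith
    have : q * B ^ (q - 1) ≤ l ^ (q - 1) := by nlinarith
    gcongr
  nlinarith

lemma Jp_diff_convex {p A B L : ℝ} (hp : 2 ≤ p) (hL : 0 < L) (hA : |A| ≤ L) (hB : |B| ≤ L) :
    |Jp p A - Jp p B| ≤ (p - 1) * L ^ (p - 2) * |A - B| := by
  -- small cases first
  have hLp : 0 < L ^ (p - 2) := Real.rpow_pos_of_pos hL _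
  have pos : ∀ A B : ℝ, 0 < B → B ≤ A → A ≤ L →
      |Jp p A - Jp p B| ≤ (p - 1) * L ^ (p - 2) * |A - B| := by
    intro A B hB hBA hAL
    have hA := hB.trans_le hBA
    rw [Jp_of_pos p hA, Jp_of_pos p hB, abs_of_nonneg (sub_nonneg.2 hBA), abs_of_nonneg
      (sub_nonneg.2 (Real.rpow_le_rpow hB.le hBA (by linarith)))]
    have := rpow_sub_le_convex (q := p - 1) (by linarith) hB hBA hAL
    rwa [show p - 1 - 1 = p - 2 by ring] at this
  have pos2 : ∀ A B : ℝ, 0 < B → 0 < A → A ≤ L → B ≤ L →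
      |Jp p A - Jp p B| ≤ (p - 1) * L ^ (p - 2) * |A - B| := by
    intro A B hB hA h1 h2
    rcases le_total B A with h | h
    · exact pos A B hB h h1
    · rw [abs_sub_comm, abs_sub_comm A]; exact pos B A hA h h2
  by_cases hs : 0 < A * B
  · rcases pos_and_pos_or_neg_and_neg_of_mul_pos hs with ⟨h1, h2⟩ | ⟨h1, h2⟩
    · exact pos2 A B h2 h1 ((le_abs_self _).trans hA) ((le_abs_self _).trans hB)
    · have := pos2 (-A) (-B) (by linarith) (by linarith) ((neg_le_abs _).trans hA)
        ((neg_le_abs _).trans hB)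
      rw [Jp_neg', Jp_neg', neg_sub_neg, neg_sub_neg, abs_sub_comm, abs_sub_comm B] at this
      exact this
  · have key : |A - B| = |A| + |B| := by
      push Not at hs
      rcases le_total 0 A with h1 | h1 <;> rcases le_total 0 B with h2 | h2
      · rcases h1.eq_or_lt with h | h
        · simp [← h]
        · have : B = 0 := by nlinarith
          simp [this]
      · rw [abs_of_nonneg h1, abs_of_nonpos h2, abs_of_nonneg (by linarith)]; ring
      · rw [abs_of_nonneg h2, abs_of_nonpos h1, abs_of_nonpos (by linarith)]; ring
      · rcases h1.eq_or_lt with h | h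
        · simp [h]
        · have : B = 0 := by nlinarith
          simp [this]
    have one : ∀ A : ℝ, |A| ≤ L → |Jp p A| ≤ L ^ (p - 2) * |A| := by
      intro A hA
      unfold Jp
      rw [abs_mul, abs_of_nonneg (Real.rpow_nonneg (abs_nonneg A) _)]
      have := Real.rpow_le_rpow (abs_nonneg A) hA (by linarith : 0 ≤ p - 2)
      gcongr
    calc |Jp p A - Jp p B| ≤ |Jp p A| + |Jp p B| := abs_sub _ _
      _ ≤ L ^ (p - 2) * |A| + L ^ (p - 2) * |B| := add_le_add (one A hA) (one B hB)
      _ = 1 * L ^ (p - 2) * |A - B| := by rw [key]; ring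
      _ ≤ _ := by gcongr; linarith

lemma Jp_diff_concave {p τ a R₁ R₂ r : ℝ} (hp : 1 < p) (hp2 : p ≤ 2) (ha : a ≠ 0) (hr : 0 < r)
    (hτ : 0 ≤ τ) (h1 : |R₁| ≤ τ * r ^ 2) (h2 : |R₂| ≤ τ * r ^ 2) :
    |Jp p (a - R₂) - Jp p (a + R₁)| ≤ 6 * τ * (|a| ^ (p - 2) * r ^ 2) := by
  have pos2 : ∀ l A B : ℝ, 0 < l → l ≤ A → l ≤ B →
      |Jp p A - Jp p B| ≤ l ^ (p - 2) * |A - B| := by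
    have : ∀ l A B : ℝ, 0 < l → l ≤ B → B ≤ A →
      |Jp p A - Jp p B| ≤ l ^ (p - 2) * |A - B| := by
      intro l A B hl hlB hBA
      have hB := hl.trans_le hlB
      have hA := hB.trans_le hBA
      rw [Jp_of_pos p hA, Jp_of_pos p hB, abs_of_nonneg (sub_nonneg.2 hBA), abs_of_nonneg
        (sub_nonneg.2 (Real.rpow_le_rpow hB.le hBA (by linarith)))]
      have := rpow_sub_le_concave (q := p - 1) (by linarith) (by linarith) hl hlB hBA
      rwa [show p - 1 - 1 = p - 2 by ring] at this
    intro l A B hl h1 h2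
    rcases le_total B A with h | h
    · exact this l A B hl h2 h
    · rw [abs_sub_comm, abs_sub_comm A]; exact this l B A hl h1 h
  have hapos : 0 < |a| := abs_pos.2 ha
  have hap : 0 < |a| ^ (p - 2) := Real.rpow_pos_of_pos hapos _
  have hR : |(a - R₂) - (a + R₁)| ≤ 2 * (τ * r ^ 2) := by
    rw [show (a - R₂) - (a + R₁) = -(R₂ + R₁) by ring, abs_neg]
    linarith [abs_add_le R₂ R₁]
  rw [abs_le] at h1 h2
  rcases le_or_gt (2 * (τ * r ^ 2)) |a| with hc | hc
  · have hl : (|a| / 2) ^ (p - 2) ≤ 2 * |a| ^ (p - 2) := by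
      rw [Real.div_rpow hapos.le (by norm_num), div_eq_mul_inv, ← Real.rpow_neg (by norm_num),
        mul_comm]
      have : (2 : ℝ) ^ (-(p - 2)) ≤ 2 ^ (1 : ℝ) :=
        Real.rpow_le_rpow_of_exponent_le (by norm_num) (by linarith)
      rw [Real.rpow_one] at this
      gcongr
    have key : |Jp p (a - R₂) - Jp p (a + R₁)| ≤
        (|a| / 2) ^ (p - 2) * |(a - R₂) - (a + R₁)| := by
      rcases lt_or_gt_of_ne ha with h | h
      · rw [abs_of_neg h] at hc ⊢
        have := pos2 (-a / 2) (-(a - R₂)) (-(a + R₁)) (by linarith) (by linarith) (by linarith)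
        rwa [Jp_neg', Jp_neg', neg_sub_neg, neg_sub_neg, abs_sub_comm, abs_sub_comm (a + R₁)]
          at this
      · rw [abs_of_pos h] at hc ⊢
        exact pos2 (a / 2) _ _ (by linarith) (by linarith) (by linarith)
    calc _ ≤ _ := key
      _ ≤ (2 * |a| ^ (p - 2)) * (2 * (τ * r ^ 2)) := by gcongr
      _ ≤ _ := by
        have : 0 ≤ τ * (|a| ^ (p - 2) * r ^ 2) := by positivity
        nlinarith
  · have hT : 0 < τ * r ^ 2 := by linarith
    have ha' := abs_lt.1 hc
    have one : ∀ A : ℝ, |A| ≤ 3 * (τ * r ^ 2) → |Jp p A| ≤ 3 * τ * (|a| ^ (p - 2) * r ^ 2) := by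
      intro A hA
      rw [abs_Jp p A hp]
      calc |A| ^ (p - 1) ≤ (3 * (τ * r ^ 2)) ^ (p - 1) :=
            Real.rpow_le_rpow (abs_nonneg _) hA (by linarith)
        _ = (3 * (τ * r ^ 2)) ^ (p - 2) * (3 * (τ * r ^ 2)) := by
            rw [show p - 1 = (p - 2) + 1 by ring, Real.rpow_add_one (by positivity)]
        _ ≤ |a| ^ (p - 2) * (3 * (τ * r ^ 2)) := by
            have := Real.rpow_le_rpow_of_nonpos hapos
              (by linarith : |a| ≤ 3 * (τ * r ^ 2)) (by linarith : p - 2 ≤ 0)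
            gcongr
        _ = _ := by ring
    have b1 := one (a - R₂) (abs_le.2 ⟨by linarith, by linarith⟩)
    have b2 := one (a + R₁) (abs_le.2 ⟨by linarith, by linarith⟩)
    have := abs_sub (Jp p (a - R₂)) (Jp p (a + R₁))
    linarith

/-- The combined pointwise bound. -/
lemma Jp_diff_main {p τ M a R₁ R₂ r : ℝ} (hp : 1 < p) (hM : 0 < M) (ha : a ≠ 0) (hr : 0 < r)
    (hr1 : r ≤ 1) (haM : |a| ≤ M * r)
    (hτ : 0 ≤ τ) (h1 : |R₁| ≤ τ * r ^ 2) (h2 : |R₂| ≤ τ * r ^ 2) :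
    |Jp p (a - R₂) - Jp p (a + R₁)| ≤
      (6 * τ + 2 * (p - 1) * (M + τ) ^ (p - 2) * τ) *
        (|a| ^ (-(max (2 - p) 0)) * r ^ (p + max (2 - p) 0)) := by
  have hMτ : 0 < M + τ := by linarith
  have hp1 : 0 < p - 1 := by linarith
  rcases le_total p 2 with hp2 | hp2
  · rw [max_eq_left (by linarith), show -(2 - p) = p - 2 by ring, show p + (2 - p) = (2:ℕ) by
      push_cast; ring, Real.rpow_natCast]
    refine (Jp_diff_concave hp hp2 ha hr hτ h1 h2).trans ?_
    gcongr
    have : 0 ≤ 2 * (p - 1) * (M + τ) ^ (p - 2) * τ := by positivity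
    linarith
  · rw [max_eq_right (by linarith), neg_zero, Real.rpow_zero, one_mul, add_zero]
    have hrr : τ * r ^ 2 ≤ τ * r := by gcongr; nlinarith
    have := Jp_diff_convex (p := p) (A := a - R₂) (B := a + R₁) (L := (M + τ) * r) hp2
      (by positivity) (by linarith [abs_sub a R₂]) (by linarith [abs_add_le a R₁])
    have hR : |(a - R₂) - (a + R₁)| ≤ 2 * (τ * r ^ 2) := by
      rw [show (a - R₂) - (a + R₁) = -(R₂ + R₁) by ring, abs_neg]
      linarith [abs_add_le R₂ R₁]
    calc _ ≤ _ := this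
      _ ≤ (p - 1) * ((M + τ) * r) ^ (p - 2) * (2 * (τ * r ^ 2)) := by gcongr
      _ = 2 * (p - 1) * (M + τ) ^ (p - 2) * τ * r ^ p := by
        rw [Real.mul_rpow hMτ.le hr.le]
        have : r ^ p = r ^ (p - 2) * r ^ 2 := by
          rw [← Real.rpow_natCast r 2, ← Real.rpow_add hr]; congr 1; push_cast; ring
        rw [this]; ring
      _ ≤ _ := by gcongr; linarith

/-- One-dimensional weight. -/
def wt (c ε : ℝ) (t : ℝ) : ℝ :=
  (Ioc 0 ε).indicator (fun u => u ^ (-c)) t + (Ioc 0 ε).indicator (fun u => u ^ (-c)) (-t)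

lemma wt_nonneg (c ε t : ℝ) : 0 ≤ wt c ε t := by
  unfold wt
  apply add_nonneg <;> exact indicator_nonneg (fun u hu => Real.rpow_nonneg hu.1.le _) _

lemma wt_eq {c ε t : ℝ} (ht : t ≠ 0) (h : |t| ≤ ε) : wt c ε t = |t| ^ (-c) := by
  unfold wt
  rcases lt_or_gt_of_ne ht with h0 | h0
  · rw [abs_of_neg h0] at *
    rw [indicator_of_notMem (by simp; intro; linarith), indicator_of_mem (by constructor <;> linarith)]
    simp
  · rw [abs_of_pos h0] at *
    rw [indicator_of_mem (by constructor <;> linarith), indicator_of_notMem (by simp; intro; linarith)]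
    simp

lemma wt_int {c ε : ℝ} (hc : c < 1) (hε : 0 < ε) :
    Integrable (wt c ε) ∧ ∫ t, wt c ε t = 2 * (ε ^ (1 - c) / (1 - c)) := by
  have hI : Integrable ((Ioc 0 ε).indicator (fun u : ℝ => u ^ (-c))) := by
    rw [integrable_indicator_iff measurableSet_Ioc]
    have := intervalIntegral.intervalIntegrable_rpow' (a := 0) (b := ε) (r := -c) (by linarith)
    rwa [intervalIntegrable_iff_integrableOn_Ioc_of_le hε.le] at this
  refine ⟨hI.add hI.comp_neg, ?_⟩
  unfold wt
  rw [integral_add hI hI.comp_neg, integral_neg_eq_self, ← two_mul,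
    integral_indicator measurableSet_Ioc, ← intervalIntegral.integral_of_le hε.le,
    integral_rpow (Or.inl (by linarith)), Real.zero_rpow (by linarith)]
  ring_nf

lemma exists_coords (N : ℕ) (i0 : Fin N) (D : Euc N →L[ℝ] ℝ) (hD : 0 < ‖D‖) :
    ∃ ψ : (Fin N → ℝ) → Euc N, MeasurePreserving ψ volume volume ∧ MeasurableEmbedding ψ ∧
      (∀ v i, |v i| ≤ ‖ψ v‖) ∧ ∀ v, |D (ψ v)| = ‖D‖ * |v i0| := by
  set w : Euc N := (InnerProductSpace.toDual ℝ (Euc N)).symm D with hw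
  have hwn : ‖w‖ = ‖D‖ := by simp [hw]
  have hwi : ∀ h, D h = inner ℝ w h := fun h => by simp [hw]
  have hw0 : ‖w‖ ≠ 0 := by rw [hwn]; exact hD.ne'
  set e : Euc N := (‖w‖⁻¹) • w with he
  have hen : ‖e‖ = 1 := by rw [he, norm_smul, norm_inv, norm_norm, inv_mul_cancel₀ hw0]
  have hor : Orthonormal ℝ (({i0} : Set (Fin N)).domRestrict (fun _ => e)) := by
    constructor
    · intro i; exact hen
    · intro i j hij
      exact absurd (Subsingleton.elim i j) hij
  obtain ⟨b, hb⟩ := hor.exists_orthonormalBasis_extension_of_card_eq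
    (by simp : Module.finrank ℝ (Euc N) = Fintype.card (Fin N))
  have hb0 : b i0 = e := hb i0 rfl
  refine ⟨fun v => b.repr.symm (WithLp.toLp 2 v), ?_, ?_, ?_, ?_⟩
  · exact b.measurePreserving_repr_symm.comp (PiLp.volume_preserving_toLp (Fin N))
  · exact b.repr.symm.toHomeomorph.measurableEmbedding.comp
      (MeasurableEquiv.toLp 2 (Fin N → ℝ)).measurableEmbedding
  · intro v i
    simp only [LinearIsometryEquiv.norm_map]
    have := PiLp.norm_apply_le (WithLp.toLp 2 v : Euc N) i
    simpa using this
  · intro v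
    have h1 : w = ‖w‖ • e := by rw [he, smul_smul, mul_inv_cancel₀ hw0, one_smul]
    rw [hwi, h1, real_inner_smul_left, abs_mul, abs_norm, ← hb0, ← b.repr_apply_apply]
    simp [hwn]

lemma prod_bound (N : ℕ) (i0 : Fin N) (v : Fin N → ℝ) {r α b c : ℝ} (hv : ∀ i, v i ≠ 0)
    (hr : ∀ i, |v i| ≤ r) (hc0 : 0 ≤ c) (hcα : α ≤ c) (hc : N * c = N - b) :
    |v i0| ^ (-α) * r ^ (-(N - α - b)) ≤ ∏ i, |v i| ^ (-c) := by
  have hpos : ∀ i, 0 < |v i| := fun i => abs_pos.2 (hv i)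
  have hr0 : 0 < r := (hpos i0).trans_le (hr i0)
  rw [← Finset.mul_prod_erase Finset.univ _ (Finset.mem_univ i0)]
  have h1 : |v i0| ^ (-c) = |v i0| ^ (-α) * |v i0| ^ (-(c - α)) := by
    rw [← Real.rpow_add (hpos i0)]; congr 1; ring
  have h2 : r ^ (-(c - α)) ≤ |v i0| ^ (-(c - α)) :=
    Real.rpow_le_rpow_of_nonpos (hpos i0) (hr i0) (by linarith)
  have h3 : ∏ i ∈ Finset.univ.erase i0, r ^ (-c) ≤ ∏ i ∈ Finset.univ.erase i0, |v i| ^ (-c) :=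
    Finset.prod_le_prod (fun i _ => Real.rpow_nonneg hr0.le _)
      (fun i _ => Real.rpow_le_rpow_of_nonpos (hpos i) (hr i) (by linarith))
  have hN : 1 ≤ N := i0.pos
  have h4 : r ^ (-(N - α - b)) = r ^ (-(c - α)) * ∏ i ∈ Finset.univ.erase i0, r ^ (-c) := by
    rw [Finset.prod_const, Finset.card_erase_of_mem (Finset.mem_univ _), Finset.card_univ,
      Fintype.card_fin, ← Real.rpow_natCast, ← Real.rpow_mul hr0.le, ← Real.rpow_add hr0]
    congr 1
    push_cast [hN]
    linarith
  rw [h1, h4, mul_assoc]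
  have h5 : 0 ≤ r ^ (-(c - α)) := Real.rpow_nonneg hr0.le _
  have h6 : 0 ≤ ∏ i ∈ Finset.univ.erase i0, r ^ (-c) :=
    Finset.prod_nonneg fun i _ => Real.rpow_nonneg hr0.le _
  have h7 : 0 ≤ |v i0| ^ (-α) := Real.rpow_nonneg (hpos i0).le _
  gcongr

lemma integral_bound (N : ℕ) (hN : 1 ≤ N) (D : Euc N →L[ℝ] ℝ) {m α β b ε C₂ : ℝ} (hm : 0 < m)
    (hD : m ≤ ‖D‖) (hα : 0 ≤ α) (hb : 0 < b) (hbβ : b ≤ β) (hbα : b ≤ 1 - α)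
    (hε : 0 < ε) (hC : 0 ≤ C₂) (f : Euc N → ℝ)
    (hf0 : ∀ h, ε ≤ ‖h‖ → f h = 0)
    (hf : ∀ h, h ≠ 0 → D h ≠ 0 → ‖h‖ < ε →
      |f h + f (-h)| ≤ C₂ * (|D h| ^ (-α) * ‖h‖ ^ (β + α - N))) :
    |∫ h, f h| ≤ C₂ * m ^ (-α) * (2 * (N / b)) ^ N * ε ^ β := by
  have hN0 : (0 : ℝ) < N := by exact_mod_cast hN
  have hrhs : 0 ≤ C₂ * m ^ (-α) * (2 * (N / b)) ^ N * ε ^ β := by positivity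
  by_cases hfi : Integrable f
  swap
  · rw [integral_undef hfi, abs_zero]; exact hrhs
  obtain ⟨ψ, hψ, hψe, hψn, hψD⟩ := exists_coords N ⟨0, hN⟩ D (hm.trans_le hD)
  set i0 : Fin N := ⟨0, hN⟩
  set c : ℝ := 1 - b / N with hcdef
  have hbN : b / N ≤ b := div_le_self hb.le (by exact_mod_cast hN)
  have hbN0 : 0 < b / N := by positivity
  have hc1 : c < 1 := by linarith
  have hcα : α ≤ c := by linarith
  have hNc : N * c = N - b := by rw [hcdef]; field_simp
  have h2 : 2 * ∫ h, f h = ∫ v, (f (ψ v) + f (-ψ v)) := by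
    rw [hψ.integral_comp hψe (fun h => f h + f (-h)), integral_add hfi hfi.comp_neg,
      integral_neg_eq_self]
    ring
  obtain ⟨hwi, hwe⟩ := wt_int (c := c) hc1 hε
  set g : (Fin N → ℝ) → ℝ := fun v => C₂ * m ^ (-α) * ε ^ (β - b) * ∏ i, wt c ε (v i) with hg
  have hgi : Integrable g := (Integrable.fintype_prod (fun _ => hwi)).const_mul _
  have hgint : ∫ v, g v = C₂ * m ^ (-α) * (2 * (N / b)) ^ N * ε ^ β := by
    rw [hg, integral_const_mul, integral_fintype_prod_volume_eq_pow, hwe, Fintype.card_fin]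
    have e1 : 1 - c = b / N := by rw [hcdef]; ring
    have e2 : 2 * (ε ^ (b / N) / (b / N)) = (2 * (N / b)) * ε ^ (b / N) := by
      field_simp
    have e3 : (ε ^ (b / N)) ^ N = ε ^ b := by
      rw [← Real.rpow_natCast, ← Real.rpow_mul hε.le]; congr 1; field_simp
    have e4 : ε ^ β = ε ^ (β - b) * ε ^ b := by rw [← Real.rpow_add hε]; congr 1; ring
    rw [e1, e2, mul_pow, e3, e4]; ring
  have hne : ∀ᵐ v : Fin N → ℝ, ∀ i, v i ≠ 0 := by
    rw [ae_all_iff]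
    intro i
    exact Measure.ae_eval_ne (fun _ => volume) i 0
  have key : ‖∫ v, (f (ψ v) + f (-ψ v))‖ ≤ ∫ v, g v := by
    refine norm_integral_le_of_norm_le hgi ?_
    filter_upwards [hne] with v hv
    rw [Real.norm_eq_abs]
    have hvpos : 0 < |v i0| := abs_pos.2 (hv i0)
    have hψpos : 0 < ‖ψ v‖ := hvpos.trans_le (hψn v i0)
    rcases le_or_gt ε ‖ψ v‖ with hle | hlt
    · rw [hf0 _ hle, hf0 _ (by rwa [norm_neg]), add_zero, abs_zero]
      have : 0 ≤ ∏ i, wt c ε (v i) := Finset.prod_nonneg fun i _ => wt_nonneg _ _ _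
      rw [hg]; positivity
    · have hDpos : 0 < |D (ψ v)| := by rw [hψD]; have := hm.trans_le hD; positivity
      refine (hf _ (norm_pos_iff.1 hψpos) (abs_pos.1 hDpos) hlt).trans ?_
      have hw : ∏ i, wt c ε (v i) = ∏ i, |v i| ^ (-c) :=
        Finset.prod_congr rfl fun i _ => wt_eq (hv i) ((hψn v i).trans hlt.le)
      have hp := prod_bound N i0 v (r := ‖ψ v‖) (α := α) (b := b) hv (hψn v) (hα.trans hcα) hcα hNc
      have e5 : ‖ψ v‖ ^ (β + α - N) = ‖ψ v‖ ^ (β - b) * ‖ψ v‖ ^ (-(N - α - b)) := by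
        rw [← Real.rpow_add hψpos]; congr 1; ring
      have e6 : ‖ψ v‖ ^ (β - b) ≤ ε ^ (β - b) :=
        Real.rpow_le_rpow hψpos.le hlt.le (by linarith)
      have e7 : |D (ψ v)| ^ (-α) ≤ m ^ (-α) * |v i0| ^ (-α) := by
        rw [hψD, Real.mul_rpow (norm_nonneg _) hvpos.le]
        have := Real.rpow_le_rpow_of_nonpos hm hD (by linarith : -α ≤ 0)
        gcongr
      rw [hg]
      simp only
      rw [hw, e5]
      calc C₂ * (|D (ψ v)| ^ (-α) * (‖ψ v‖ ^ (β - b) * ‖ψ v‖ ^ (-(N - α - b))))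
          ≤ C₂ * (m ^ (-α) * |v i0| ^ (-α) * (ε ^ (β - b) * ‖ψ v‖ ^ (-(N - α - b)))) := by
            gcongr
        _ = C₂ * m ^ (-α) * ε ^ (β - b) * (|v i0| ^ (-α) * ‖ψ v‖ ^ (-(N - α - b))) := by ring
        _ ≤ _ := by gcongr
  rw [← h2, hgint, Real.norm_eq_abs, abs_mul, abs_two] at key
  linarith [abs_nonneg (∫ h, f h)]

lemma taylor_bound {N : ℕ} {u : Euc N → ℝ} {Du : Euc N → (Euc N →L[ℝ] ℝ)}
    {D2u : Euc N → (Euc N →L[ℝ] Euc N →L[ℝ] ℝ)} {x : Euc N} {ε τ : ℝ}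
    (h1 : ∀ y ∈ ball x ε, HasFDerivAt u (Du y) y)
    (h2 : ∀ y ∈ ball x ε, HasFDerivAt Du (D2u y) y)
    (h3 : ∀ y ∈ ball x ε, ‖D2u y‖ ≤ τ) (hτ : 0 ≤ τ) (h : Euc N) (hh : ‖h‖ < ε) :
    |u (x + h) - u x - Du x h| ≤ τ * ‖h‖ ^ 2 := by
  have hε : 0 < ε := (norm_nonneg h).trans_lt hh
  have hx : x ∈ ball x ε := mem_ball_self hε
  have hxh : x + h ∈ ball x ε := by simpa [mem_ball, dist_eq_norm] using hh
  have hseg : segment ℝ x (x + h) ⊆ ball x ε := (convex_ball x ε).segment_subset hx hxh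
  have hsn : ∀ y ∈ segment ℝ x (x + h), ‖y - x‖ ≤ ‖h‖ := by
    intro y hy
    have := norm_sub_le_of_mem_segment hy
    simpa using this
  have hg : ∀ y ∈ segment ℝ x (x + h),
      HasFDerivWithinAt (fun y => u y - Du x y) (Du y - Du x) (segment ℝ x (x + h)) y := by
    intro y hy
    exact ((h1 y (hseg hy)).sub (Du x).hasFDerivAt).hasFDerivWithinAt
  have hb : ∀ y ∈ segment ℝ x (x + h), ‖Du y - Du x‖ ≤ τ * ‖h‖ := by
    intro y hy
    have := (convex_ball x ε).norm_image_sub_le_of_norm_hasFDerivWithin_le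
      (fun z hz => (h2 z hz).hasFDerivWithinAt) h3 hx (hseg hy)
    refine this.trans ?_
    gcongr
    exact hsn y hy
  have := (convex_segment x (x + h)).norm_image_sub_le_of_norm_hasFDerivWithin_le hg hb
    (left_mem_segment ℝ _ _) (right_mem_segment ℝ _ _)
  rw [Real.norm_eq_abs] at this
  simp only [map_add, add_sub_cancel_left] at this
  calc _ = |u (x + h) - (Du x x + Du x h) - (u x - Du x x)| := by congr 1; ring
    _ ≤ _ := this
    _ = _ := by ring

lemma ball_subset_of_frontier {N : ℕ} {U : Set (Euc N)} (hU : IsOpen U) {x : Euc N} (hx : x ∈ U)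
    {ε : ℝ} (hε : 0 < ε) (h : ∀ z ∈ frontier U, ε ≤ dist x z) : ball x ε ⊆ U := by
  have hpre : IsPreconnected (ball x ε) := (convex_ball x ε).isPreconnected
  rw [isPreconnected_iff_subset_of_disjoint] at hpre
  have hcov : ball x ε ⊆ U ∪ (closure U)ᶜ := by
    intro y hy
    by_cases hyU : y ∈ U
    · exact Or.inl hyU
    · right
      intro hyc
      have : y ∈ frontier U := by rw [hU.frontier_eq]; exact ⟨hyc, hyU⟩
      have := h y this
      rw [mem_ball, dist_comm] at hy
      linarith
  have hdis : ball x ε ∩ (U ∩ (closure U)ᶜ) = ∅ := by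
    rw [eq_empty_iff_forall_notMem]
    rintro y ⟨-, h1, h2⟩
    exact h2 (subset_closure h1)
  rcases hpre U (closure U)ᶜ hU isClosed_closure.isOpen_compl hcov hdis with h1 | h1
  · exact h1
  · exact absurd (subset_closure hx) (h1 (mem_ball_self hε))

/-- uniform bound on annular integrals of `J_p(φ(x,t)-φ(y,t)) K(x-y)`
at points where the spatial gradient does not vanish. -/
theorem pv_exists_bound
    (N : ℕ) (hN : 1 ≤ N) (p s Lam τ m M : ℝ)
    (hp : 1 < p) (hs : s ∈ Ioo (0 : ℝ) 1) (hLam : 0 < Lam) (hm : 0 < m) (hτ : 0 ≤ τ)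
    (hM : m ≤ M) :
    ∃ C : ℝ, 0 < C ∧
      ∀ (K : Euc N → ℝ),
        Measurable K → (∀ z : Euc N, z ≠ 0 → 0 < K z) →
        (∀ z : Euc N, z ≠ 0 → K (-z) = K z) →
        (∀ z : Euc N, z ≠ 0 → K z ≤ Lam * ‖z‖ ^ (-((N : ℝ) + s * p))) →
      ∀ (Ω U 𝒦 : Set (Euc N)) (I : Set ℝ)
        (φ : Euc N → ℝ → ℝ) (Dφ : Euc N → ℝ → (Euc N →L[ℝ] ℝ))
        (D2φ : Euc N → ℝ → (Euc N →L[ℝ] Euc N →L[ℝ] ℝ)) (φt : Euc N → ℝ → ℝ),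
        IsOpen Ω → IsCompact 𝒦 → 𝒦 ⊆ Ω →
        Bornology.IsBounded I → I.OrdConnected →
        IsOpen U → 𝒦 ⊆ U → IsCompact (closure U) → closure U ⊆ Ω →
        C2xC1t N U I φ Dφ D2φ φt →
        (∀ x ∈ U, ∀ t ∈ I, ‖D2φ x t‖ ≤ τ) →
        (∀ x ∈ 𝒦, ∀ t ∈ I, m ≤ ‖Dφ x t‖ ∧ ‖Dφ x t‖ ≤ M) →
        ∀ x ∈ 𝒦, ∀ t ∈ I, ∀ δ ε : ℝ, 0 < δ → δ < ε →
          ε < min (sInf (Set.image2 dist 𝒦 (frontier U))) 1 →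
          |∫ y in ball x ε \ ball x δ, Jp p (φ x t - φ y t) * K (x - y)| ≤
            C * ε ^ (p * (1 - s)) := by

  obtain ⟨hs0, hs1⟩ := hs
  have hM0 : 0 < M := hm.trans_le hM
  have hp1 : 0 < p - 1 := by linarith
  have hMτ : 0 < M + τ := by linarith
  have hN0 : (0 : ℝ) < N := by exact_mod_cast hN
  set α : ℝ := max (2 - p) 0 with hα
  have hα0 : 0 ≤ α := le_max_right _ _
  have hα1 : α < 1 := max_lt (by linarith) one_pos
  set β : ℝ := p * (1 - s) with hβ
  have hβ0 : 0 < β := mul_pos (by linarith) (by linarith)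
  set b : ℝ := min β (1 - α) with hb
  have hb0 : 0 < b := lt_min hβ0 (by linarith)
  set C₁ : ℝ := 6 * τ + 2 * (p - 1) * (M + τ) ^ (p - 2) * τ with hC₁
  have hC₁0 : 0 ≤ C₁ := by positivity
  refine ⟨C₁ * Lam * m ^ (-α) * (2 * (N / b)) ^ N + 1, by positivity, ?_⟩
  intro K hKm hKpos hKsym hKle Ω U 𝒦 I φ Dφ D2φ φt hΩ h𝒦 h𝒦Ω hIb hIc hU h𝒦U hUc hUΩ hφ hD2 hDφ
    x hx t ht δ ε hδ hδε hε
  obtain ⟨-, hd1, -, hd2, -⟩ := hφ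
  have hε0 : 0 < ε := hδ.trans hδε
  have hε1 : ε < 1 := hε.trans_le (min_le_right _ _)
  have hball : ball x ε ⊆ U := by
    refine ball_subset_of_frontier hU (h𝒦U hx) hε0 ?_
    intro z hz
    refine (hε.trans_le (min_le_left _ _)).le.trans ?_
    refine csInf_le ⟨0, ?_⟩ (mem_image2_of_mem hx hz)
    rintro _ ⟨a, -, c, -, rfl⟩
    exact dist_nonneg
  set F : Euc N → ℝ := fun y => Jp p (φ x t - φ y t) * K (x - y) with hF
  set f : Euc N → ℝ := fun h => (ball x ε \ ball x δ).indicator F (x + h) with hf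
  have hmem : ∀ h, x + h ∈ ball x ε \ ball x δ ↔ ‖h‖ < ε ∧ δ ≤ ‖h‖ := by
    intro h
    simp [mem_ball, dist_eq_norm]
  have hint : ∫ y in ball x ε \ ball x δ, F y = ∫ h, f h := by
    rw [← integral_indicator (measurableSet_ball.diff measurableSet_ball), hf,
      integral_add_left_eq_self (fun y => (ball x ε \ ball x δ).indicator F y) x]
  have htay := taylor_bound (u := fun y => φ y t) (Du := fun y => Dφ y t)
    (D2u := fun y => D2φ y t) (x := x) (ε := ε) (τ := τ)
    (fun y hy => hd1 y (hball hy) t ht) (fun y hy => hd2 y (hball hy) t ht)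
    (fun y hy => hD2 y (hball hy) t ht) hτ
  obtain ⟨hDm, hDM⟩ := hDφ x hx t ht
  have main := integral_bound N hN (Dφ x t) (α := α) (β := β) (b := b) (ε := ε) (C₂ := C₁ * Lam)
    hm hDm hα0 hb0 (min_le_left _ _) (min_le_right _ _) hε0 (by positivity) f ?_ ?_
  · change |∫ y in ball x ε \ ball x δ, F y| ≤ _
    rw [hint]
    refine main.trans ?_
    have : 0 ≤ ε ^ β := by positivity
    linarith
  · intro h hh
    exact indicator_of_notMem (fun h' => absurd ((hmem h).1 h').1 (not_lt.2 hh)) _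
  · intro h h0 hDh hhε
    have hr : 0 < ‖h‖ := norm_pos_iff.2 h0
    by_cases hδh : δ ≤ ‖h‖
    swap
    · have e1 : f h = 0 := indicator_of_notMem (fun h' => hδh ((hmem h).1 h').2) _
      have e2 : f (-h) = 0 := indicator_of_notMem
        (fun h' => hδh (by simpa using ((hmem (-h)).1 h').2)) _
      rw [e1, e2, add_zero, abs_zero]
      positivity
    · have e1 : f h = F (x + h) := indicator_of_mem ((hmem h).2 ⟨hhε, hδh⟩) _
      have e2 : f (-h) = F (x + -h) := indicator_of_mem
        ((hmem (-h)).2 ⟨by simpa using hhε, by simpa using hδh⟩) _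
      have t1 := htay h hhε
      have t2 := htay (-h) (by simpa using hhε)
      rw [norm_neg] at t2
      set a := Dφ x t h with ha
      set R₁ := φ (x + h) t - φ x t - a with hR₁
      set R₂ := φ (x + -h) t - φ x t - Dφ x t (-h) with hR₂
      have k1 : F (x + h) = -Jp p (a + R₁) * K h := by
        simp only [hF]
        rw [← Jp_neg', show x - (x + h) = -h by abel, hKsym h h0]
        congr 2; rw [hR₁]; ring
      have k2 : F (x + -h) = Jp p (a - R₂) * K h := by
        simp only [hF]
        rw [show x - (x + -h) = h by abel]
        congr 2; rw [hR₂, map_neg]; ring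
      have hJ := Jp_diff_main hp hM0 hDh hr (hhε.trans hε1).le
        (((Dφ x t).le_opNorm h).trans (by gcongr) : |a| ≤ M * ‖h‖) hτ t1 t2
      rw [e1, e2, k1, k2, show -Jp p (a + R₁) * K h + Jp p (a - R₂) * K h =
        (Jp p (a - R₂) - Jp p (a + R₁)) * K h by ring, abs_mul, abs_of_pos (hKpos h h0)]
      calc _ ≤ (C₁ * (|a| ^ (-α) * ‖h‖ ^ (p + α))) * (Lam * ‖h‖ ^ (-((N : ℝ) + s * p))) :=
            mul_le_mul hJ (hKle h h0) (hKpos h h0).le (by positivity)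
        _ = C₁ * Lam * (|a| ^ (-α) * (‖h‖ ^ (p + α) * ‖h‖ ^ (-((N : ℝ) + s * p)))) := by ring
        _ = _ := by
          rw [← Real.rpow_add hr]
          congr 3
          rw [hβ]; ring
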